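/- arXiv:2102.09015 — 2 statements merged into one kernel-verified Lean document; each statement's English description precedes it below -/
import Mathlib

section
/- Let R be a commutative Noetherian ring, M a finitely generated R-module, and a, b ideals linked by I over M (i.e., I ⊆ a ∩ b is generated by an M-regular sequence, aM ≠ M ≠ bM, bM = IM :_M a and aM = IM :_M b). If aM ∩ bM ≠ IM, then grade(a + b, M) = grade(a, M). -/
open RingTheory.Sequence

/-- The submodule `N :_M c = { m ∈ M | c • m ⊆ N }`. -/
def smulColon {A : Type} [CommRing A] {M : Type} [AddCommGroup M] [Module A M]
    (N : Submodule A M) (c : Ideal A) : Submodule A M :=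
  ⨅ r ∈ c, N.comap (DistribMulAction.toLinearMap A M r)

/-- `grade(c, M)`: the common length of maximal `M`-regular sequences inside `c`. -/
noncomputable def mgrade {A : Type} [CommRing A] (c : Ideal A) (M : Type) [AddCommGroup M]
    [Module A M] : ℕ :=
  sSup {n : ℕ | ∃ rs : List A, rs.length = n ∧ (∀ r ∈ rs, r ∈ c) ∧ IsRegular M rs}

open CategoryTheory Abelian in
/-- If `Ext N M i` vanishes for all `i ≤ n` and `rs` is a weakly `M`-regular sequence of length `n`,
then every linear map from `N` to `M ⧸ rs M` is zero. -/
theorem subsingleton_linearMap_quotient_of_subsingleton_ext {R : Type} [CommRing R]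
    (N : ModuleCat.{0} R) (rs : List R) (M : ModuleCat.{0} R) (hreg : IsWeaklyRegular M rs)
    (hext : ∀ i ≤ rs.length, Subsingleton (Ext N M i)) :
    Subsingleton (N →ₗ[R] M ⧸ (Ideal.ofList rs • ⊤ : Submodule R M)) := by
  induction rs generalizing M with
  | nil =>
    have : Subsingleton (N →ₗ[R] M) :=
      (Ext.addEquiv₀.trans ModuleCat.homAddEquiv).symm.toEquiv.subsingleton_congr.mpr
        (hext 0 le_rfl)
    have hbot : (Ideal.ofList ([] : List R) • ⊤ : Submodule R M) = ⊥ := by simp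
    exact (LinearEquiv.congrRight (Submodule.quotEquivOfEqBot _ hbot)).toEquiv.subsingleton
  | cons r rs ih =>
    obtain ⟨hr, hrs⟩ := (isWeaklyRegular_cons_iff M r rs).mp hreg
    have hsub := ih (ModuleCat.of R (QuotSMulTop r M)) hrs fun i hi ↦ by
      have hzero := AddCommGrpCat.isZero_of_iff_subsingleton.mpr
        (hext i (by rw [List.length_cons]; omega))
      have hzero' := AddCommGrpCat.isZero_of_iff_subsingleton.mpr
        (hext (i + 1) (by rw [List.length_cons]; omega))
      exact AddCommGrpCat.subsingleton_of_isZero <| ShortComplex.Exact.isZero_of_both_zeros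
        (Ext.covariant_sequence_exact₃' N hr.smulShortComplex_shortExact i (i + 1) rfl)
        (hzero.eq_zero_of_src _) (hzero'.eq_zero_of_tgt _)
    exact (LinearEquiv.congrRight
      (Submodule.quotOfListConsSMulTopEquivQuotSMulTopInner M r rs)).toEquiv.subsingleton

/-- An `M`-regular sequence `rs` in `c` computes the grade of `c` as soon as `c` kills a nonzero
element of `M ⧸ rs M`. -/
theorem mgrade_eq_length_of_smul_mem {R : Type} [CommRing R] [IsNoetherianRing R]
    {M : Type} [AddCommGroup M] [Module R M] [Module.Finite R M] {c : Ideal R} {rs : List R}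
    (hreg : IsRegular M rs) (hrs : ∀ r ∈ rs, r ∈ c) {x : M}
    (hx : x ∉ (Ideal.ofList rs • ⊤ : Submodule R M))
    (hcx : ∀ r ∈ c, r • x ∈ (Ideal.ofList rs • ⊤ : Submodule R M)) :
    mgrade c M = rs.length := by
  have hne : (c • ⊤ : Submodule R M) ≠ ⊤ := fun htop ↦ by
    obtain ⟨r, hr, hr0⟩ := Submodule.exists_sub_one_mem_and_smul_eq_zero_of_fg_of_le_smul c
      (⊤ : Submodule R M) Module.Finite.fg_top htop.ge
    have hmem := hcx _ hr
    rw [sub_smul, one_smul, hr0 x trivial, zero_sub, neg_mem_iff] at hmem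
    exact hx hmem
  refine IsGreatest.csSup_eq ⟨⟨rs, rfl, hrs, hreg⟩, ?_⟩
  rintro _ ⟨ss, rfl, hss, hssreg⟩
  by_contra! hlt
  have hsub := subsingleton_linearMap_quotient_of_subsingleton_ext (ModuleCat.of R (R ⧸ c)) rs
    (ModuleCat.of R M) hreg.toIsWeaklyRegular fun i hi ↦
      ModuleCat.subsingleton_ext_of_exists_isRegular c (ModuleCat.of R (R ⧸ c))
        (by rw [Module.support_eq_zeroLocus, Ideal.annihilator_quotient])
        (ModuleCat.of R M) hne.lt_top ss hss hssreg i (hi.trans_lt hlt)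
  let f : (R ⧸ c) →ₗ[R] M ⧸ (Ideal.ofList rs • ⊤ : Submodule R M) :=
    Submodule.liftQ c (LinearMap.toSpanSingleton R _ (Submodule.Quotient.mk x)) fun r hr ↦ by
      rw [LinearMap.mem_ker, LinearMap.toSpanSingleton_apply, ← Submodule.Quotient.mk_smul,
        Submodule.Quotient.mk_eq_zero]
      exact hcx r hr
  have hf : f (Submodule.Quotient.mk 1) = Submodule.Quotient.mk x :=
    (Submodule.liftQ_apply _ _ _).trans (one_smul R _)
  have hf0 : f = 0 := hsub.elim f 0
  rw [hf0, LinearMap.zero_apply, eq_comm, Submodule.Quotient.mk_eq_zero] at hf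
  exact hx hf

theorem mem_smulColon {A : Type} [CommRing A] {M : Type} [AddCommGroup M] [Module A M]
    {N : Submodule A M} {c : Ideal A} {x : M} : x ∈ smulColon N c ↔ ∀ r ∈ c, r • x ∈ N := by
  simp only [smulColon, Submodule.mem_iInf, Submodule.mem_comap]
  rfl

/-- If `a` and `b` are linked by `I` over `M` and `aM ∩ bM ≠ IM`,
then `grade(a + b, M) = mgrade(a, M)`. -/
theorem stmt2 (R : Type) [CommRing R] [IsNoetherianRing R]
    (M : Type) [AddCommGroup M] [Module R M] [Module.Finite R M]
    (a b I : Ideal R) (rs : List R) (hIrs : I = Ideal.ofList rs) (hreg : IsRegular M rs)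
    (hI : I ≤ a ⊓ b)
    (haM : (a • ⊤ : Submodule R M) ≠ ⊤) (hbM : (b • ⊤ : Submodule R M) ≠ ⊤)
    (hlink1 : (b • ⊤ : Submodule R M) = smulColon (I • ⊤) a)
    (hlink2 : (a • ⊤ : Submodule R M) = smulColon (I • ⊤) b)
    (hne : (a • ⊤ : Submodule R M) ⊓ (b • ⊤ : Submodule R M) ≠ (I • ⊤ : Submodule R M)) :
    mgrade (a ⊔ b) M = mgrade a M := by
  subst hIrs
  have hle : (Ideal.ofList rs • ⊤ : Submodule R M) ≤ a • ⊤ ⊓ b • ⊤ :=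
    le_inf (Submodule.smul_mono_left (hI.trans inf_le_left))
      (Submodule.smul_mono_left (hI.trans inf_le_right))
  obtain ⟨x, ⟨hxa, hxb⟩, hx⟩ := SetLike.exists_of_lt (hle.lt_of_ne' hne)
  have hax := mem_smulColon.mp (hlink1 ▸ hxb)
  have hbx := mem_smulColon.mp (hlink2 ▸ hxa)
  have hrs : ∀ r ∈ rs, r ∈ a := fun r hr ↦ (hI (Ideal.subset_span hr)).1
  rw [mgrade_eq_length_of_smul_mem hreg hrs hx hax]
  refine mgrade_eq_length_of_smul_mem hreg (fun r hr ↦ Ideal.mem_sup_left (hrs r hr)) hx ?_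
  intro r hr
  obtain ⟨s, hs, t, ht, rfl⟩ := Submodule.mem_sup.mp hr
  rw [add_smul]
  exact add_mem (hax s hs) (hbx t ht)
end

section
/- Let R_0 be a commutative Noetherian ring, R = R_0[x,y] with the standard grading, M a finitely generated graded R-module, r_1, r_2 ∈ R_0, and suppose r_1 x, r_2 y is an M-regular sequence. Then for all t, t' ≥ 1: (r_1 x^t, r_2 y^{t'}, r_1 r_2 x^{t-1} y^{t'-1})M = (r_1 x^t, r_2 y^{t'})M :_M (x,y). -/
open RingTheory.Sequence

local notation "R" R₀ => MvPolynomial (Fin 2) R₀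

section ColonOfRegularPair

variable {A M : Type*} [CommRing A] [AddCommGroup M] [Module A M]

/-- `d` is a non-zerodivisor on `M / cM`. -/
def IsSMulRegularMod (M : Type*) [AddCommGroup M] [Module A M] (c d : A) : Prop :=
  ∀ m n : M, d • m = c • n → ∃ k : M, m = c • k

namespace IsSMulRegularMod

theorem of_isSMulRegular_quotSMulTop {c d : A} (h : IsSMulRegular (QuotSMulTop c M) d) :
    IsSMulRegularMod M c d := by
  intro m n hmn
  have hm := (isSMulRegular_quotient_iff_mem_of_smul_mem _ _).mp h m
    (hmn ▸ Submodule.smul_mem_pointwise_smul n c ⊤ trivial)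
  obtain ⟨k, -, hk⟩ := (Submodule.mem_smul_pointwise_iff_exists _ _ _).mp hm
  exact ⟨k, hk.symm⟩

theorem one_left (d : A) : IsSMulRegularMod M 1 d := fun m _ _ => ⟨m, (one_smul A m).symm⟩

theorem one_right (c : A) : IsSMulRegularMod M c 1 := fun m n h => ⟨n, by rwa [one_smul] at h⟩

theorem of_mul_left {c c' d : A} (hc : IsSMulRegular M c) (h : IsSMulRegularMod M (c * c') d) :
    IsSMulRegularMod M c' d := by
  intro m n hmn
  obtain ⟨k, hk⟩ := h (c • m) n (by rw [smul_comm, hmn, mul_smul])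
  exact ⟨k, hc (by simpa only [mul_smul] using hk)⟩

theorem mul_left {c c' d : A} (hc : IsSMulRegular M c) (h : IsSMulRegularMod M c d)
    (h' : IsSMulRegularMod M c' d) : IsSMulRegularMod M (c * c') d := by
  intro m n hmn
  rw [mul_smul] at hmn
  obtain ⟨k, rfl⟩ := h m _ hmn
  obtain ⟨l, rfl⟩ := h' k n (hc (by simpa only [smul_comm c d] using hmn))
  exact ⟨l, (mul_smul c c' l).symm⟩

theorem pow_left {c d : A} (hc : IsSMulRegular M c) (h : IsSMulRegularMod M c d) (i : ℕ) :
    IsSMulRegularMod M (c ^ i) d := by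
  induction i with
  | zero => exact pow_zero c ▸ one_left d
  | succ i ih => exact pow_succ' c i ▸ mul_left hc h ih

theorem of_mul_right {c d d' : A} (h : IsSMulRegularMod M c (d * d')) :
    IsSMulRegularMod M c d' := by
  intro m n hmn
  exact h m (d • n) (by rw [mul_smul, hmn, smul_comm])

theorem mul_right {c d d' : A} (h : IsSMulRegularMod M c d) (h' : IsSMulRegularMod M c d') :
    IsSMulRegularMod M c (d * d') := by
  intro m n hmn
  rw [mul_smul] at hmn
  obtain ⟨k, hk⟩ := h _ n hmn
  exact h' m k hk

theorem pow_right {c d : A} (h : IsSMulRegularMod M c d) (i : ℕ) :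
    IsSMulRegularMod M c (d ^ i) := by
  induction i with
  | zero => exact pow_zero d ▸ one_right c
  | succ i ih => exact pow_succ d i ▸ mul_right ih h

end IsSMulRegularMod

theorem mem_span_pair_smul_top {a b : A} {m : M} :
    m ∈ (Ideal.span {a, b} • ⊤ : Submodule A M) ↔ ∃ u v : M, m = a • u + b • v := by
  simp only [Ideal.span_insert, Submodule.sup_smul, Submodule.ideal_span_singleton_smul,
    Submodule.mem_sup, Submodule.mem_smul_pointwise_iff_exists, Submodule.mem_top, true_and,
    exists_exists_eq_and, eq_comm (a := m)]

theorem mem_span_triple_smul_top {a b c : A} {m : M} :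
    m ∈ (Ideal.span {a, b, c} • ⊤ : Submodule A M) ↔
      ∃ u v w : M, m = a • u + b • v + c • w := by
  rw [Ideal.span_insert, Submodule.sup_smul, Submodule.mem_sup]
  simp only [Submodule.ideal_span_singleton_smul, Submodule.mem_smul_pointwise_iff_exists,
    Submodule.mem_top, true_and, exists_exists_eq_and, mem_span_pair_smul_top]
  constructor
  · rintro ⟨u, _, ⟨v, w, rfl⟩, rfl⟩
    exact ⟨u, v, w, (add_assoc _ _ _).symm⟩
  · rintro ⟨u, v, w, rfl⟩
    exact ⟨u, _, ⟨v, w, rfl⟩, (add_assoc _ _ _).symm⟩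

theorem mem_smulColon_span_pair {A M : Type} [CommRing A] [AddCommGroup M] [Module A M]
    {N : Submodule A M} {a b : A} {m : M} :
    m ∈ smulColon N (Ideal.span {a, b}) ↔ a • m ∈ N ∧ b • m ∈ N := by
  simp only [smulColon, Submodule.mem_iInf, Submodule.mem_comap]
  refine ⟨fun h => ⟨h a (Ideal.subset_span (by simp)), h b (Ideal.subset_span (by simp))⟩, ?_⟩
  rintro ⟨ha, hb⟩ r hr
  obtain ⟨p, q, rfl⟩ := Ideal.mem_span_pair.mp hr
  change (p * a + q * b) • m ∈ N
  rw [add_smul, mul_smul, mul_smul]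
  exact N.add_mem (N.smul_mem p ha) (N.smul_mem q hb)

theorem exists_eq_of_smul_eq_of_isSMulRegularMod {r s x y : A} (n k : ℕ)
    (hreg : IsSMulRegular M (r * x)) (hmod : IsSMulRegularMod M (r * x) (s * y))
    {m u v u' v' : M} (hx : x • m = (r * x ^ (n + 1)) • u + (s * y ^ (k + 1)) • v)
    (hy : y • m = (r * x ^ (n + 1)) • u' + (s * y ^ (k + 1)) • v') :
    ∃ a b c : M, m = (r * x ^ (n + 1)) • a + (s * y ^ (k + 1)) • b +
      (r * s * x ^ n * y ^ k) • c := by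
  have hr : IsSMulRegular M r := by
    rw [mul_comm] at hreg; exact hreg.of_mul
  have hx_reg : IsSMulRegular M x := hreg.of_mul
  have hx_mod : IsSMulRegularMod M x (s * y) := .of_mul_left hr hmod
  have hr_mod : IsSMulRegularMod M r (s * y) := .of_mul_left hx_reg (mul_comm r x ▸ hmod)
  have hx_y : IsSMulRegularMod M x y := hx_mod.of_mul_right
  have pow_mod {c : A} (h : IsSMulRegularMod M c (s * y)) :
      IsSMulRegularMod M c (s * y ^ (k + 1)) :=
    .mul_right (.of_mul_right (mul_comm s y ▸ h)) (h.of_mul_right.pow_right _)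
  obtain ⟨v₁, rfl⟩ := pow_mod hx_mod v (m - (r * x ^ n) • u) (by
    rw [smul_sub, hx]; module)
  have hm : m = (r * x ^ n) • u + (s * y ^ (k + 1)) • v₁ := hx_reg (by
    simp only [hx]; module)
  obtain ⟨w, hw⟩ := pow_mod (.mul_left hr hr_mod (hx_mod.pow_left hx_reg n)) (v' - y • v₁)
    (y • u - x • u') (by
      have h := hy
      rw [hm] at h
      linear_combination (norm := module) -h)
  have hyu : y • u = x • u' + (s * y ^ (k + 1)) • w := by
    refine (hr.mul (hx_reg.pow n)) ?_
    have h := hy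
    rw [hm, eq_add_of_sub_eq hw] at h
    simp only
    linear_combination (norm := module) h
  obtain ⟨z, hz⟩ := hx_y (u - (s * y ^ k) • w) u' (by rw [smul_sub, hyu]; module)
  refine ⟨z, v₁, w, ?_⟩
  rw [hm, eq_add_of_sub_eq hz]
  module

end ColonOfRegularPair

/-- Over `R = R₀[x,y]`, if `r₁x, r₂y` is an `M`-regular sequence, then
for all `t, t' ≥ 1`:
`(r₁xᵗ, r₂y^{t'}, r₁r₂x^{t-1}y^{t'-1})M = (r₁xᵗ, r₂y^{t'})M :_M (x,y)`. -/
theorem stmt5 (R₀ : Type) [CommRing R₀] [IsNoetherianRing R₀]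
    (M : Type) [AddCommGroup M] [Module (R R₀) M] [Module.Finite (R R₀) M]
    -- the grading on `M`
    (ℳ : ℤ → AddSubgroup M) [DirectSum.Decomposition ℳ]
    (hgr : ∀ (j : ℤ) (p : R R₀) (d : ℕ), p.IsHomogeneous d → ∀ m ∈ ℳ j, p • m ∈ ℳ (j + d))
    (r₁ r₂ : R₀) (t t' : ℕ) (ht : 1 ≤ t) (ht' : 1 ≤ t')
    (hreg : IsRegular M [(MvPolynomial.C r₁ * MvPolynomial.X (0 : Fin 2) : R R₀),
                          MvPolynomial.C r₂ * MvPolynomial.X (1 : Fin 2)]) :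
    (Ideal.span {MvPolynomial.C r₁ * MvPolynomial.X (0 : Fin 2) ^ t,
        MvPolynomial.C r₂ * MvPolynomial.X (1 : Fin 2) ^ t',
        MvPolynomial.C r₁ * MvPolynomial.C r₂ *
          MvPolynomial.X (0 : Fin 2) ^ (t - 1) * MvPolynomial.X (1 : Fin 2) ^ (t' - 1)}
        • ⊤ : Submodule (R R₀) M)
      = smulColon
          (Ideal.span {MvPolynomial.C r₁ * MvPolynomial.X (0 : Fin 2) ^ t,
              MvPolynomial.C r₂ * MvPolynomial.X (1 : Fin 2) ^ t'} • ⊤)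
          (Ideal.span {(MvPolynomial.X (0 : Fin 2) : R R₀), MvPolynomial.X (1 : Fin 2)}) := by
  obtain ⟨n, rfl⟩ := Nat.exists_eq_add_of_le' ht
  obtain ⟨k, rfl⟩ := Nat.exists_eq_add_of_le' ht'
  obtain ⟨h₁, h₂⟩ := (isWeaklyRegular_cons_iff _ _ _).mp hreg.toIsWeaklyRegular
  have hmod := IsSMulRegularMod.of_isSMulRegular_quotSMulTop
    ((isWeaklyRegular_cons_iff _ _ _).mp h₂).1
  ext m
  simp only [mem_smulColon_span_pair, mem_span_triple_smul_top, mem_span_pair_smul_top,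
    Nat.add_sub_cancel]
  constructor
  · rintro ⟨a, b, c, rfl⟩
    constructor
    · refine ⟨(MvPolynomial.X 0 : R R₀) • a + (MvPolynomial.C r₂ * MvPolynomial.X (1 : Fin 2) ^ k) • c,
        (MvPolynomial.X 0 : R R₀) • b, ?_⟩
      module
    · refine ⟨(MvPolynomial.X 1 : R R₀) • a,
        (MvPolynomial.X 1 : R R₀) • b + (MvPolynomial.C r₁ * MvPolynomial.X (0 : Fin 2) ^ n) • c, ?_⟩
      module
  · rintro ⟨⟨u, v, hx⟩, u', v', hy⟩
    exact exists_eq_of_smul_eq_of_isSMulRegularMod n k h₁ hmod hx hy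
end
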